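/- Let g be a cubic graph and let e, f ∈ E(g) be two edges that are not incident to each other (they share no endpoint). Then the Whitehead moves on e and on f commute: for any choice of types i, j ∈ {1,2}, performing w_e^{(i)} and then w_f^{(j)} yields the same graph as performing w_f^{(j)} and then w_e^{(i)}. -/

import Mathlib

/-! Cubic multigraphs in the dart (half-edge) model, Whitehead moves,
and the "graph of graphs" `Γ_n`. -/

/-- A cubic multigraph on the `2 * n` vertices `Fin (2 * n)`, in the dart (half-edge) model:
darts are `Fin (6 * n)`, `dinv` is the fixed-point-free involution exchanging the two darts of
each edge, and `vert` assigns to each dart its base vertex.  Loops and multiple edges are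
allowed; `regular` says every vertex carries exactly three darts. -/
structure CubicGraph (n : ℕ) where
  vert : Fin (6 * n) → Fin (2 * n)
  dinv : Fin (6 * n) → Fin (6 * n)
  dinv_invol : ∀ d, dinv (dinv d) = d
  dinv_ne : ∀ d, dinv d ≠ d
  regular : ∀ v : Fin (2 * n), (Finset.univ.filter fun d => vert d = v).card = 3

namespace CubicGraph

variable {n : ℕ}

/-- Two darts are joined if they can be connected by a chain of
"same vertex" / "other half of the same edge" steps. -/
def Reach (g : CubicGraph n) : Fin (6 * n) → Fin (6 * n) → Prop :=
  Relation.ReflTransGen fun a b => g.vert a = g.vert b ∨ g.dinv a = b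

/-- Connectivity of a cubic multigraph. -/
def Connected (g : CubicGraph n) : Prop := ∀ d d', g.Reach d d'

/-- The edge of the dart `d` is a loop. -/
def IsLoop (g : CubicGraph n) (d : Fin (6 * n)) : Prop := g.vert (g.dinv d) = g.vert d

instance (g : CubicGraph n) (d : Fin (6 * n)) : Decidable (g.IsLoop d) :=
  inferInstanceAs (Decidable (_ = _))

lemma card_filter_comp_swap (g : CubicGraph n) (q r : Fin (6 * n)) (v : Fin (2 * n)) :
    (Finset.univ.filter fun d => g.vert (Equiv.swap q r d) = v).card
      = (Finset.univ.filter fun d => g.vert d = v).card := by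
  refine Finset.card_bij (fun d _ => Equiv.swap q r d) ?_ ?_ ?_
  · intro a ha
    simp only [Finset.mem_filter, Finset.mem_univ, true_and] at ha ⊢
    exact ha
  · intro a _ b _ h
    exact (Equiv.swap q r).injective h
  · intro b hb
    simp only [Finset.mem_filter, Finset.mem_univ, true_and] at hb
    exact ⟨Equiv.swap q r b, by simp [hb], by simp⟩

/-- Exchange the base vertices of the two darts `q` and `r`, keeping everything else. -/
def swapDarts (g : CubicGraph n) (q r : Fin (6 * n)) : CubicGraph n where
  vert := fun d => g.vert (Equiv.swap q r d)
  dinv := g.dinv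
  dinv_invol := g.dinv_invol
  dinv_ne := g.dinv_ne
  regular := fun v => (g.card_filter_comp_swap q r v).trans (g.regular v)

/-- The darts based at the same vertex as `x`, other than `x` itself. -/
def othersAt (g : CubicGraph n) (x : Fin (6 * n)) : Finset (Fin (6 * n)) :=
  (Finset.univ.filter fun d => g.vert d = g.vert x).erase x

lemma othersAt_nonempty (g : CubicGraph n) (x : Fin (6 * n)) :
    (g.othersAt x).Nonempty := by
  have hx : x ∈ Finset.univ.filter fun d => g.vert d = g.vert x := by simp
  have h : (g.othersAt x).card = 2 := by
    rw [othersAt, Finset.card_erase_of_mem hx, g.regular]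
  rw [← Finset.card_pos, h]
  norm_num

def oMin (g : CubicGraph n) (x : Fin (6 * n)) : Fin (6 * n) :=
  (g.othersAt x).min' (g.othersAt_nonempty x)

def oMax (g : CubicGraph n) (x : Fin (6 * n)) : Fin (6 * n) :=
  (g.othersAt x).max' (g.othersAt_nonempty x)

/-- The two Whitehead moves (indexed by `i : Fin 2`) performed on the edge containing the dart
`x`.  On a loop the move leaves the graph unchanged; on a non-loop edge the two darts at the
endpoints of the edge other than the edge's own darts are re-attached in one of the two
possible new ways (realized by transporting one dart from each endpoint to the other). -/
def wh (g : CubicGraph n) (i : Fin 2) (x : Fin (6 * n)) : CubicGraph n :=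
  if g.IsLoop x then g
  else if i = 0 then g.swapDarts (g.oMax x) (g.oMin (g.dinv x))
  else g.swapDarts (g.oMax x) (g.oMax (g.dinv x))

/-- An isomorphism of cubic multigraphs: a bijection of darts together with a compatible
bijection of vertices, commuting with the edge involutions. -/
structure Iso (g₁ g₂ : CubicGraph n) where
  dartEquiv : Fin (6 * n) ≃ Fin (6 * n)
  vertEquiv : Fin (2 * n) ≃ Fin (2 * n)
  map_dinv : ∀ d, g₂.dinv (dartEquiv d) = dartEquiv (g₁.dinv d)
  map_vert : ∀ d, g₂.vert (dartEquiv d) = vertEquiv (g₁.vert d)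

def IsIsomorphic (g₁ g₂ : CubicGraph n) : Prop := Nonempty (Iso g₁ g₂)

/-- Reachability avoiding the edge of the dart `x` (i.e. in the graph with that edge removed). -/
def ReachAvoiding (g : CubicGraph n) (x : Fin (6 * n)) :
    Fin (6 * n) → Fin (6 * n) → Prop :=
  Relation.ReflTransGen fun a b =>
    g.vert a = g.vert b ∨ (g.dinv a = b ∧ a ≠ x ∧ a ≠ g.dinv x)

/-- The edge of `x` is a bridge: removing it disconnects the graph. -/
def IsBridge (g : CubicGraph n) (x : Fin (6 * n)) : Prop :=
  ¬ ∀ d d', g.ReachAvoiding x d d'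

/-- A (connected) graph is bridged if it has at least one bridge. -/
def Bridged (g : CubicGraph n) : Prop := ∃ x, g.IsBridge x

/-- A graph is bridgeless if it has no bridge. -/
def Bridgeless (g : CubicGraph n) : Prop := ∀ x, ¬ g.IsBridge x

/-- `c` lists consecutive darts of a cycle of length `k`: the vertices visited are pairwise
distinct, the end of each dart's edge is the base of the next one (cyclically), and the `k`
edges used are pairwise distinct. -/
def IsCycle (g : CubicGraph n) (k : ℕ) (c : Fin k → Fin (6 * n)) : Prop :=
  (∀ i : Fin k,
    g.vert (g.dinv (c i)) = g.vert (c ⟨(i.1 + 1) % k, Nat.mod_lt _ i.pos⟩)) ∧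
  Function.Injective (fun i => g.vert (c i)) ∧
  ∀ i j : Fin k, c j ≠ g.dinv (c i)

/-- The cycle `c` is indecomposable (induced): no edge of `g` other than the cycle's own
edges joins two vertices of the cycle. -/
def Indecomposable (g : CubicGraph n) (k : ℕ) (c : Fin k → Fin (6 * n)) : Prop :=
  ∀ d, (∃ i, g.vert d = g.vert (c i)) → (∃ j, g.vert (g.dinv d) = g.vert (c j)) →
    ∃ i, d = c i ∨ d = g.dinv (c i)

/-- The girth: the least length of a cycle. -/
noncomputable def girth (g : CubicGraph n) : ℕ :=
  sInf {k | 0 < k ∧ ∃ c : Fin k → Fin (6 * n), g.IsCycle k c}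

/-- The only cycles of the graph are loops. -/
def OnlyLoopCycles (g : CubicGraph n) : Prop :=
  ∀ k, 2 ≤ k → ∀ c : Fin k → Fin (6 * n), ¬ g.IsCycle k c

/-- The number of darts lying on loops (each loop contributes two darts). -/
def loopCount (g : CubicGraph n) : ℕ :=
  (Finset.univ.filter fun d => g.IsLoop d).card

end CubicGraph

instance {n : ℕ} : Finite (CubicGraph n) := by
  have hinj : Function.Injective fun g : CubicGraph n => (g.vert, g.dinv) := by
    rintro ⟨v₁, i₁, _, _, _⟩ ⟨v₂, i₂, _, _, _⟩ h
    simp only [Prod.mk.injEq] at h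
    obtain ⟨h₁, h₂⟩ := h
    subst h₁; subst h₂; rfl
  exact Finite.of_injective _ hinj

/-- Isomorphism of connected cubic graphs. -/
def cgIso {n : ℕ} (g₁ g₂ : {g : CubicGraph n // g.Connected}) : Prop :=
  CubicGraph.IsIsomorphic g₁.1 g₂.1

/-- The vertex set of the graph of graphs `Γ_n`: isomorphism classes of connected cubic
multigraphs on `2 * n` vertices. -/
abbrev GammaV (n : ℕ) := Quot (@cgIso n)

/-- The number of directed edges of `Γ_n` from the class `u` to the class `v`: one edge for
each Whitehead move of a representative of `u` whose result lies in the class `v`.  A move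
specification is a pair `(i, x)` of a move type `i : Fin 2` and a dart `x`; each of the two
Whitehead moves of each edge is counted by exactly two specifications (one for each of the
two darts of the edge), whence the division by `2`. -/
noncomputable def edgeMult (n : ℕ) (u v : GammaV n) : ℕ :=
  Nat.card {p : Fin 2 × Fin (6 * n) //
    CubicGraph.IsIsomorphic ((Quot.out u).1.wh p.1 p.2) (Quot.out v).1} / 2

/-- The sum of out-degrees of the classes in `S` (every class has out-degree `6 * n`:
two Whitehead moves for each of the `3 * n` edges). -/
noncomputable def dOut (n : ℕ) (S : Set (GammaV n)) : ℕ :=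
  Nat.card {q : GammaV n × Fin 2 × Fin (6 * n) // q.1 ∈ S} / 2

/-- The number of directed edges of `Γ_n` from `S` to its complement. -/
noncomputable def boundaryCount (n : ℕ) (S : Set (GammaV n)) : ℕ :=
  Nat.card {q : GammaV n × Fin 2 × Fin (6 * n) // q.1 ∈ S ∧
    ∀ v : GammaV n,
      CubicGraph.IsIsomorphic ((Quot.out q.1).1.wh q.2.1 q.2.2) (Quot.out v).1 → v ∉ S} / 2

/-- The outer conductance of a set `S` of vertices of `Γ_n`. -/
noncomputable def phiOutSet (n : ℕ) (S : Set (GammaV n)) : ℝ :=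
  (boundaryCount n S : ℝ) / min (dOut n S : ℝ) (dOut n Sᶜ : ℝ)

/-- The outer conductance of `Γ_n`: the infimum of the outer conductances of nonempty
proper subsets of vertices. -/
noncomputable def phiOut (n : ℕ) : ℝ :=
  sInf {x : ℝ | ∃ S : Set (GammaV n), S.Nonempty ∧ Sᶜ.Nonempty ∧ x = phiOutSet n S}

/-- The set of classes of bridged cubic graphs. -/
def bridgedSet (n : ℕ) : Set (GammaV n) := {u | (Quot.out u).1.Bridged}

namespace CubicGraph

variable {n : ℕ}

/-- The dart at the far endpoint of an edge that the Whitehead move of type `i` relocates;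
`x` is the dart of the edge based at that endpoint. -/
def partner (g : CubicGraph n) (i : Fin 2) (x : Fin (6 * n)) : Fin (6 * n) :=
  if i = 0 then g.oMin x else g.oMax x

lemma wh_of_isLoop {g : CubicGraph n} {x : Fin (6 * n)} (h : g.IsLoop x) (i : Fin 2) :
    g.wh i x = g := by
  simp [wh, h]

lemma wh_of_not_isLoop {g : CubicGraph n} {x : Fin (6 * n)} (h : ¬ g.IsLoop x) (i : Fin 2) :
    g.wh i x = g.swapDarts (g.oMax x) (g.partner i (g.dinv x)) := by
  rw [wh, if_neg h, partner]
  split_ifs <;> rfl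

lemma vert_eq_of_mem_othersAt {g : CubicGraph n} {x d : Fin (6 * n)} (h : d ∈ g.othersAt x) :
    g.vert d = g.vert x := by
  simpa using Finset.mem_of_mem_erase h

lemma vert_oMin (g : CubicGraph n) (x : Fin (6 * n)) : g.vert (g.oMin x) = g.vert x :=
  vert_eq_of_mem_othersAt (Finset.min'_mem _ _)

lemma vert_oMax (g : CubicGraph n) (x : Fin (6 * n)) : g.vert (g.oMax x) = g.vert x :=
  vert_eq_of_mem_othersAt (Finset.max'_mem _ _)

lemma vert_partner (g : CubicGraph n) (i : Fin 2) (x : Fin (6 * n)) :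
    g.vert (g.partner i x) = g.vert x := by
  rw [partner]
  split_ifs
  exacts [g.vert_oMin x, g.vert_oMax x]

lemma vert_swapDarts_eq_iff (g : CubicGraph n) {q r : Fin (6 * n)} {v : Fin (2 * n)}
    (hq : g.vert q ≠ v) (hr : g.vert r ≠ v) (d : Fin (6 * n)) :
    (g.swapDarts q r).vert d = v ↔ g.vert d = v := by
  change g.vert (Equiv.swap q r d) = v ↔ _
  rcases eq_or_ne d q with rfl | hdq
  · simp [hq, hr]
  rcases eq_or_ne d r with rfl | hdr
  · simp [hq, hr]
  rw [Equiv.swap_apply_of_ne_of_ne hdq hdr]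

lemma vert_swapDarts (g : CubicGraph n) {q r z : Fin (6 * n)}
    (hq : g.vert q ≠ g.vert z) (hr : g.vert r ≠ g.vert z) :
    (g.swapDarts q r).vert z = g.vert z :=
  (g.vert_swapDarts_eq_iff hq hr z).2 rfl

lemma othersAt_swapDarts (g : CubicGraph n) {q r z : Fin (6 * n)}
    (hq : g.vert q ≠ g.vert z) (hr : g.vert r ≠ g.vert z) :
    (g.swapDarts q r).othersAt z = g.othersAt z := by
  simp only [othersAt, g.vert_swapDarts hq hr, g.vert_swapDarts_eq_iff hq hr]

lemma oMin_swapDarts (g : CubicGraph n) {q r z : Fin (6 * n)}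
    (hq : g.vert q ≠ g.vert z) (hr : g.vert r ≠ g.vert z) :
    (g.swapDarts q r).oMin z = g.oMin z := by
  simp only [oMin, g.othersAt_swapDarts hq hr]

lemma oMax_swapDarts (g : CubicGraph n) {q r z : Fin (6 * n)}
    (hq : g.vert q ≠ g.vert z) (hr : g.vert r ≠ g.vert z) :
    (g.swapDarts q r).oMax z = g.oMax z := by
  simp only [oMax, g.othersAt_swapDarts hq hr]

lemma partner_swapDarts (g : CubicGraph n) (i : Fin 2) {q r z : Fin (6 * n)}
    (hq : g.vert q ≠ g.vert z) (hr : g.vert r ≠ g.vert z) :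
    (g.swapDarts q r).partner i z = g.partner i z := by
  simp only [partner, g.oMin_swapDarts hq hr, g.oMax_swapDarts hq hr]

lemma isLoop_swapDarts_iff (g : CubicGraph n) {q r x : Fin (6 * n)}
    (hq : g.vert q ≠ g.vert x) (hr : g.vert r ≠ g.vert x) :
    (g.swapDarts q r).IsLoop x ↔ g.IsLoop x := by
  rw [IsLoop, g.vert_swapDarts hq hr]
  exact g.vert_swapDarts_eq_iff hq hr _

/-- Exchanges of two disjoint pairs of darts commute. -/
lemma swapDarts_comm (g : CubicGraph n) {q r q' r' : Fin (6 * n)}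
    (hqq : q ≠ q') (hqr : q ≠ r') (hrq : r ≠ q') (hrr : r ≠ r') :
    (g.swapDarts q r).swapDarts q' r' = (g.swapDarts q' r').swapDarts q r := by
  have h (d) : Equiv.swap q r (Equiv.swap q' r' d) = Equiv.swap q' r' (Equiv.swap q r d) := by
    grind
  simp only [swapDarts, h]

/-- A Whitehead move commutes with the trivial move on a loop away from its edge. -/
lemma wh_wh_comm_of_isLoop {g : CubicGraph n} {x y : Fin (6 * n)} (hx : g.IsLoop x)
    (h₁ : g.vert x ≠ g.vert y) (h₂ : g.vert x ≠ g.vert (g.dinv y)) (i j : Fin 2) :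
    (g.wh i x).wh j y = (g.wh j y).wh i x := by
  rw [wh_of_isLoop hx]
  by_cases hy : g.IsLoop y
  · rw [wh_of_isLoop hy, wh_of_isLoop hx]
  · rw [wh_of_not_isLoop hy, wh_of_isLoop]
    rwa [isLoop_swapDarts_iff]
    · rw [vert_oMax]; exact h₁.symm
    · rw [vert_partner]; exact h₂.symm

/-- The Whitehead move on a non-loop edge keeps its description after exchanging two darts
based away from the edge. -/
lemma wh_swapDarts {g : CubicGraph n} {q r x : Fin (6 * n)} (hx : ¬ g.IsLoop x)
    (hq : g.vert q ≠ g.vert x) (hr : g.vert r ≠ g.vert x)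
    (hq' : g.vert q ≠ g.vert (g.dinv x)) (hr' : g.vert r ≠ g.vert (g.dinv x)) (i : Fin 2) :
    (g.swapDarts q r).wh i x =
      (g.swapDarts q r).swapDarts (g.oMax x) (g.partner i (g.dinv x)) := by
  rw [wh_of_not_isLoop (by rwa [isLoop_swapDarts_iff g hq hr]), oMax_swapDarts g hq hr]
  exact congrArg _ (partner_swapDarts g i hq' hr')

end CubicGraph

open CubicGraph

/-- Whitehead moves performed on two non-incident edges (edges sharing no
endpoint) commute, for any choice of the types of the two moves. -/
theorem whitehead_moves_commute (n : ℕ) (g : CubicGraph n) (hg : g.Connected)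
    (x y : Fin (6 * n))
    (h₁ : g.vert x ≠ g.vert y) (h₂ : g.vert x ≠ g.vert (g.dinv y))
    (h₃ : g.vert (g.dinv x) ≠ g.vert y) (h₄ : g.vert (g.dinv x) ≠ g.vert (g.dinv y)) :
    ∀ i j : Fin 2, (g.wh i x).wh j y = (g.wh j y).wh i x := by
  intro i j
  by_cases hx : g.IsLoop x
  · exact wh_wh_comm_of_isLoop hx h₁ h₂ i j
  by_cases hy : g.IsLoop y
  · exact (wh_wh_comm_of_isLoop hy h₁.symm h₃.symm j i).symm
  have hqx := g.vert_oMax x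
  have hrx := g.vert_partner i (g.dinv x)
  have hqy := g.vert_oMax y
  have hry := g.vert_partner j (g.dinv y)
  rw [wh_of_not_isLoop hx, wh_of_not_isLoop hy, wh_swapDarts hy, wh_swapDarts hx,
    swapDarts_comm]
  all_goals grind
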